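/- Let G be a finite group, K a normal subgroup of G, and x ∈ G such that G = K⟨x⟩ and the order of K is coprime to the order of x. Then the conjugacy class x^G has the ⋆-property. -/

import Mathlib

open scoped Pointwise

/-- The conjugacy class `x^G` has the ⋆-property: every `y ∈ x^G` is conjugate to `x`
by an element of the subgroup generated by `x` and `y`. -/
def StarProperty {G : Type*} [Group G] (x : G) : Prop :=
  ∀ y ∈ {z : G | ∃ g : G, g * x * g⁻¹ = z},
    ∃ h ∈ Subgroup.closure ({x, y} : Set G), y = h * x * h⁻¹

/-- If the order of a finite subgroup `L` is coprime to the order of `x` and `x` normalizes `L`,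
then every `y ∈ L x` with `y ^ orderOf x = 1` is conjugate to `x` by an element of `L`.
Counting shows that every element of `L x` is `k (x u) k⁻¹` with `k ∈ L` and `u ∈ L` commuting
with `x`. -/
theorem exists_mem_conj_eq_of_coprime {G : Type*} [Group G] (L : Subgroup G) [Finite L] {x y : G}
    (hcop : Nat.Coprime (Nat.card L) (orderOf x)) (hx : ∀ l ∈ L, x * l * x⁻¹ ∈ L)
    (hyL : y * x⁻¹ ∈ L) (hy : y ^ orderOf x = 1) : ∃ k ∈ L, y = k * x * k⁻¹ := by
  obtain ⟨e, he0, he1⟩ := Nat.chineseRemainder hcop 0 1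
  have pow_eq_self {z : G} (hz : z ^ orderOf x = 1) : z ^ e = z := by
    simpa using pow_eq_pow_iff_modEq.mpr (he1.of_dvd (orderOf_dvd_of_pow_eq_one hz))
  have pow_eq_one {u : G} (hu : u ∈ L) : u ^ e = 1 :=
    orderOf_dvd_iff_pow_eq_one.mp
      ((L.orderOf_dvd_natCard hu).trans (Nat.modEq_zero_iff_dvd.mp he0))
  have conj_pow_eq {k u : G} (hu : u ∈ L) (hux : Commute x u) :
      (k * (x * u) * k⁻¹) ^ e = k * x * k⁻¹ := by
    rw [conj_pow, hux.mul_pow, pow_eq_self (pow_orderOf_eq_one x), pow_eq_one hu, mul_one]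
  let C : Subgroup L := (Subgroup.centralizer {x}).subgroupOf L
  have commute_of_mem (u : C) : Commute x (u : L) :=
    (Subgroup.mem_centralizer_singleton_iff.mp (Subgroup.mem_subgroupOf.mp u.2)).symm
  let f : (L ⧸ C) × C → L := fun p =>
    ⟨(p.1.out : G) * (x * (p.2 : L)) * (p.1.out : G)⁻¹ * x⁻¹, by
      have h := L.mul_mem p.1.out.2
        (hx _ (L.mul_mem (p.2 : L).2 (L.inv_mem p.1.out.2)))
      simpa only [mul_assoc] using h⟩
  have hf : Function.Injective f := by
    rintro ⟨q, u⟩ ⟨r, v⟩ h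
    have h1 : (q.out : G) * (x * (u : L)) * (q.out : G)⁻¹ =
        (r.out : G) * (x * (v : L)) * (r.out : G)⁻¹ :=
      mul_right_cancel (congrArg Subtype.val h)
    have h2 := congrArg (· ^ e) h1
    simp only [conj_pow_eq (u : L).2 (commute_of_mem u),
      conj_pow_eq (v : L).2 (commute_of_mem v)] at h2
    have hqr : q = r := by
      rw [← q.out_eq', ← r.out_eq']
      refine QuotientGroup.eq.mpr
        (Subgroup.mem_subgroupOf.mpr (Subgroup.mem_centralizer_singleton_iff.mpr ?_))
      push_cast
      have h3 : x = (q.out : G)⁻¹ * ((r.out : G) * x * (r.out : G)⁻¹) * q.out := by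
        rw [← h2]; group
      calc (q.out : G)⁻¹ * r.out * x
          = (q.out : G)⁻¹ * (r.out * x * (r.out : G)⁻¹) * q.out * ((q.out : G)⁻¹ * r.out) := by
            group
        _ = x * ((q.out : G)⁻¹ * r.out) := by rw [← h3]
    subst hqr
    simpa using h1
  have hcard : Nat.card L ≤ Nat.card ((L ⧸ C) × C) := by
    rw [Nat.card_prod, ← C.card_eq_card_quotient_mul_card_subgroup]
  obtain ⟨⟨q, u⟩, hqu⟩ := (hf.bijective_of_nat_card_le hcard).surjective ⟨y * x⁻¹, hyL⟩
  have h : (q.out : G) * (x * (u : L)) * (q.out : G)⁻¹ = y :=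
    mul_right_cancel (congrArg Subtype.val hqu)
  refine ⟨q.out, q.out.2, ?_⟩
  rw [← conj_pow_eq (u : L).2 (commute_of_mem u), h, pow_eq_self hy]

theorem star_of_coprime_complement {G : Type*} [Group G] [Fintype G]
    (K : Subgroup G) (hK : K.Normal) (x : G)
    (hgen : (K : Set G) * (Subgroup.zpowers x : Set G) = Set.univ)
    (hcop : Nat.Coprime (Nat.card K) (orderOf x)) :
    StarProperty x := by
  rintro y ⟨g, rfl⟩
  set y := g * x * g⁻¹ with hy
  set H := Subgroup.closure ({x, y} : Set G)
  have hxH : x ∈ H := Subgroup.subset_closure (by simp)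
  have hyH : y ∈ H := Subgroup.subset_closure (by simp)
  have hyK : y * x⁻¹ ∈ K := by
    obtain ⟨k, hk, _, ⟨i, rfl⟩, hg⟩ := hgen.symm ▸ Set.mem_univ g
    have h : y * x⁻¹ = k * (x * k⁻¹ * x⁻¹) := by
      rw [hy, ← hg]; group
    rw [h]
    exact K.mul_mem hk (hK.conj_mem _ (K.inv_mem hk) x)
  obtain ⟨k, hk, hyk⟩ := exists_mem_conj_eq_of_coprime (K ⊓ H) (x := x) (y := y)
    (hcop.coprime_dvd_left (Subgroup.card_dvd_of_le inf_le_left))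
    (fun l hl => ⟨hK.conj_mem l hl.1 x, H.mul_mem (H.mul_mem hxH hl.2) (H.inv_mem hxH)⟩)
    ⟨hyK, H.mul_mem hyH (H.inv_mem hxH)⟩
    (by rw [hy, conj_pow, pow_orderOf_eq_one, mul_one, mul_inv_cancel])
  exact ⟨k, hk.2, hyk⟩
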